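/- The total Lebesgue measure of the Arnol'd tongues at level ε tends to zero as ε tends to zero: writing R(ε) := {τ ∈ [0, 1] : ρ(τ, ε) ∈ ℚ}, one has Leb(R(ε)) → 0 as ε → 0⁺. Equivalently, the Lebesgue measure of the set of τ ∈ [0,1] with irrational rotation number tends to 1 as ε → 0⁺. -/

import Mathlib

open MeasureTheory Real Filter Set Function

noncomputable section

/-- The lift `f_{τ,ε}(x) = x + τ − ε sin (2πx)` of the deterministic Arnol'd standard
circle map. -/
def fStd (τ ε : ℝ) (x : ℝ) : ℝ := x + τ - ε * Real.sin (2 * π * x)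

section


structure Sys (f g N S : ℝ → ℝ) (M : ℝ) : Prop where
  hf : ∀ x, HasDerivAt f (g x) x
  hg : ∀ x, HasDerivAt g (g x * N x) x
  hN : ∀ x, HasDerivAt N (S x + N x ^ 2 / 2) x
  pf : ∀ x, f (x + 1) = f x + 1
  pg : ∀ x, g (x + 1) = g x
  pN : ∀ x, N (x + 1) = N x
  g1 : ∀ x, 1 / 2 ≤ g x
  g2 : ∀ x, g x ≤ 2
  hS : ∀ x, |S x| ≤ M
  hM : 0 < M

def PP (f g : ℝ → ℝ) (n : ℕ) (x : ℝ) : ℝ := ∏ i ∈ Finset.range n, g (f^[i] x)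
def Ph (f g N : ℝ → ℝ) (n : ℕ) (x : ℝ) : ℝ := ∑ i ∈ Finset.range n, N (f^[i] x) * PP f g i x
def Ps (f g S : ℝ → ℝ) (n : ℕ) (x : ℝ) : ℝ := ∑ i ∈ Finset.range n, S (f^[i] x) * PP f g i x ^ 2

variable {f g N S : ℝ → ℝ} {M : ℝ}

lemma PP_succ (n : ℕ) (x : ℝ) : PP f g (n+1) x = PP f g n x * g (f^[n] x) := by
  simp [PP, Finset.prod_range_succ]

lemma Sys.iter_add_one (h : Sys f g N S M) (n : ℕ) (x : ℝ) : f^[n] (x + 1) = f^[n] x + 1 := by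
  induction n with
  | zero => simp
  | succ n ih => rw [iterate_succ_apply', iterate_succ_apply', ih, h.pf]

lemma Sys.iter_add_int (h : Sys f g N S M) (n : ℕ) (x : ℝ) (m : ℤ) :
    f^[n] (x + m) = f^[n] x + m := by
  have hp : Function.Periodic (fun x => f^[n] x - x) 1 := by
    intro x; simp [h.iter_add_one]
  have := hp.int_mul m x
  simp only [mul_one] at this
  linarith

lemma Sys.PP_pos (h : Sys f g N S M) (n : ℕ) (x : ℝ) : 0 < PP f g n x :=
  Finset.prod_pos fun i _ => by linarith [h.g1 (f^[i] x)]

lemma Sys.deriv_iter (h : Sys f g N S M) (n : ℕ) (x : ℝ) : HasDerivAt (f^[n]) (PP f g n x) x := by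
  induction n with
  | zero => simpa [PP] using hasDerivAt_id x
  | succ n ih =>
    rw [iterate_succ', PP_succ, mul_comm]
    exact (h.hf _).comp x ih

lemma Sys.deriv_PP (h : Sys f g N S M) (n : ℕ) (x : ℝ) :
    HasDerivAt (PP f g n) (PP f g n x * Ph f g N n x) x := by
  induction n with
  | zero =>
    have : PP f g 0 = fun _ => 1 := by ext; simp [PP]
    rw [this]; simpa [Ph] using hasDerivAt_const x (1:ℝ)
  | succ n ih =>
    have : PP f g (n+1) = fun x => PP f g n x * g (f^[n] x) := by ext; rw [PP_succ]
    rw [this]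
    have h2 := ih.mul ((h.hg _).comp x (h.deriv_iter n x))
    refine h2.congr_deriv ?_
    simp only [Ph, Finset.sum_range_succ, comp]
    ring

lemma Sys.deriv_Ph (h : Sys f g N S M) (n : ℕ) (x : ℝ) :
    HasDerivAt (Ph f g N n) (Ps f g S n x + Ph f g N n x ^ 2 / 2) x := by
  induction n with
  | zero =>
    have : Ph f g N 0 = fun _ => 0 := by ext; simp [Ph]
    rw [this]; simpa [Ps] using hasDerivAt_const x (0:ℝ)
  | succ n ih =>
    have : Ph f g N (n+1) = fun x => Ph f g N n x + N (f^[n] x) * PP f g n x := by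
      ext; simp [Ph, Finset.sum_range_succ]
    rw [this]
    have h2 := ih.add (((h.hN _).comp x (h.deriv_iter n x)).mul (h.deriv_PP n x))
    refine h2.congr_deriv ?_
    simp only [Ps, Finset.sum_range_succ, comp]
    ring

lemma Sys.Ph_periodic (h : Sys f g N S M) (n : ℕ) : Function.Periodic (Ph f g N n) 1 := by
  intro x
  simp [Ph, PP, h.iter_add_one, h.pN, h.pg]

lemma Sys.Ph_bound (h : Sys f g N S M) (n : ℕ) (hP : ∀ i < n, ∀ x, PP f g i x ≤ 2) (x : ℝ) :
    |Ph f g N n x| ≤ √(8 * M * n) := by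
  have hc : Continuous (fun x => Ph f g N n x ^ 2) :=
    (continuous_iff_continuousAt.2 fun x => (h.deriv_Ph n x).continuousAt).pow 2
  obtain ⟨y, _, hy⟩ := (isCompact_Icc (a := (0:ℝ)) (b := 1)).exists_isMaxOn
    ⟨0, by simp⟩ hc.continuousOn
  have hmax : ∀ z, Ph f g N n z ^ 2 ≤ Ph f g N n y ^ 2 := by
    intro z
    obtain ⟨w, hw, e⟩ := (h.Ph_periodic n).exists_mem_Ico₀ one_pos z
    rw [e]; exact hy (Ico_subset_Icc_self hw)
  have hd : HasDerivAt (fun x => Ph f g N n x ^ 2) _ y := (h.deriv_Ph n y).pow 2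
  have hz := IsLocalMax.hasDerivAt_eq_zero (Filter.Eventually.of_forall hmax) hd
  have hps : |Ps f g S n y| ≤ 4 * M * n := by
    refine (Finset.abs_sum_le_sum_abs _ _).trans ?_
    calc _ ≤ ∑ i ∈ Finset.range n, 4 * M := by
          refine Finset.sum_le_sum fun i hi => ?_
          rw [abs_mul, abs_of_nonneg (sq_nonneg (PP f g i y))]
          have h1 := hP i (Finset.mem_range.1 hi) y
          have h2 := h.PP_pos i y
          have h3 := h.hS (f^[i] y)
          have : PP f g i y ^ 2 ≤ 4 := by nlinarith
          nlinarith [abs_nonneg (S (f^[i] y)), sq_nonneg (PP f g i y), h.hM]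
      _ = _ := by simp; ring
  have hyb : Ph f g N n y ^ 2 ≤ 8 * M * n := by
    have h0 : 0 ≤ 8 * M * n := by have := h.hM; positivity
    simp at hz
    rcases hz with hz | hz
    · rw [hz]; simpa using h0
    · have := neg_abs_le (Ps f g S n y); nlinarith
  rw [← Real.sqrt_sq_eq_abs]
  exact Real.sqrt_le_sqrt ((hmax x).trans hyb)

lemma interp {d d1 d2 : ℝ → ℝ} {A B : ℝ} (hA : 0 < A) (hB : 0 < B)
    (h1 : ∀ x, HasDerivAt d (d1 x) x) (h2 : ∀ x, HasDerivAt d1 (d2 x) x)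
    (hd : ∀ x, |d x| ≤ A) (hd2 : ∀ x, |d2 x| ≤ B) (x : ℝ) : |d1 x| ≤ 3 * √(A * B) := by
  set t := √(A / B) with ht
  have htp : 0 < t := Real.sqrt_pos.2 (by positivity)
  have e1 : A / t = √(A * B) := by
    rw [ht, Real.sqrt_div hA.le, Real.sqrt_mul hA.le, div_div_eq_mul_div, div_eq_iff (by positivity)]
    nth_rewrite 1 [← Real.mul_self_sqrt hA.le]; ring
  have e2 : B * t = √(A * B) := by
    rw [ht, Real.sqrt_div hA.le, Real.sqrt_mul hA.le, mul_div_assoc', div_eq_iff (by positivity)]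
    nth_rewrite 1 [← Real.mul_self_sqrt hB.le]; ring
  obtain ⟨y, hy, e⟩ := exists_hasDerivAt_eq_slope d d1 (show x < x + t by linarith)
    (fun z _ => (h1 z).continuousAt.continuousWithinAt) (fun z _ => h1 z)
  have hb1 : |d1 y| ≤ 2 * (A / t) := by
    rw [e, abs_div, show x + t - x = t by ring, abs_of_pos htp, ← mul_div_assoc]
    gcongr
    calc _ ≤ |d (x+t)| + |d x| := abs_sub _ _
      _ ≤ _ := by linarith [hd (x+t), hd x]
  have hb2 : |d1 y - d1 x| ≤ B * t := by
    have := Convex.norm_image_sub_le_of_norm_hasDerivWithin_le (f := d1) (f' := d2) (C := B)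
      (s := univ) (x := x) (y := y) (fun z _ => (h2 z).hasDerivWithinAt)
      (fun z _ => by simpa using hd2 z) convex_univ trivial trivial
    simp only [Real.norm_eq_abs] at this
    refine this.trans ?_
    gcongr
    rw [abs_of_pos (by linarith [hy.1])]; linarith [hy.2]
  have : |d1 x| ≤ |d1 y| + |d1 y - d1 x| := by
    have := abs_sub_abs_le_abs_sub (d1 x) (d1 y)
    rw [abs_sub_comm] at this; linarith
  rw [e1] at hb1; rw [e2] at hb2; linarith

lemma Sys.mono_iter (h : Sys f g N S M) (n : ℕ) : StrictMono (f^[n]) :=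
  strictMono_of_hasDerivAt_pos (h.deriv_iter n) (fun x => h.PP_pos n x)

lemma Sys.iterG (h : Sys f g N S M) (a : ℕ) (b : ℤ) (n : ℕ) (x : ℝ) :
    (fun y => f^[a] y + (b:ℝ))^[n] x = f^[a * n] x + n * b := by
  induction n with
  | zero => simp
  | succ n ih =>
    rw [iterate_succ_apply', ih]
    have := h.iter_add_int a (f^[a * n] x) (n * b)
    push_cast at this
    rw [this, ← iterate_add_apply, show a * (n+1) = a + a * n by ring]
    push_cast; ring

lemma Sys.limG (h : Sys f g N S M) {α : ℝ}
    (hα : ∀ x, Tendsto (fun n : ℕ => (f^[n] x - x) / n) atTop (nhds α)) (a : ℕ) (b : ℤ) (x : ℝ) :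
    Tendsto (fun n : ℕ => ((fun y => f^[a] y + (b:ℝ))^[n] x - x) / n) atTop (nhds (a * α + b)) := by
  rcases Nat.eq_zero_or_pos a with rfl | ha
  · refine tendsto_const_nhds.congr' ?_
    filter_upwards [eventually_gt_atTop 0] with n hn
    have : (n:ℝ) ≠ 0 := by positivity
    rw [h.iterG]; simp; field_simp
  · have h1 := (hα x).comp (tendsto_id.const_mul_atTop' ha : Tendsto (fun n : ℕ => a * n) atTop atTop)
    have h2 := (h1.const_mul (a:ℝ)).add_const (b:ℝ)
    refine h2.congr' ?_
    filter_upwards [eventually_gt_atTop 0] with n hn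
    have : (n:ℝ) ≠ 0 := by positivity
    have : (a:ℝ) ≠ 0 := by positivity
    rw [h.iterG]; simp; field_simp; ring

lemma Sys.order (h : Sys f g N S M) {α : ℝ}
    (hα : ∀ x, Tendsto (fun n : ℕ => (f^[n] x - x) / n) atTop (nhds α)) {a c : ℕ} {b d : ℤ} {x : ℝ}
    (hx : f^[a] x + b ≤ f^[c] x + d) : a * α + b ≤ c * α + d := by
  refine le_of_tendsto_of_tendsto' (h.limG hα a b x) (h.limG hα c d x) fun n => ?_
  have hc : Function.Commute (fun y => f^[a] y + (b:ℝ)) (fun y => f^[c] y + (d:ℝ)) := by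
    intro y
    simp only [h.iter_add_int, ← iterate_add_apply, add_comm a c]
    ring
  have := hc.iterate_le_of_map_le ((h.mono_iter a).monotone.add_const _)
    ((h.mono_iter c).monotone.add_const _) hx n
  gcongr

lemma pigeon (q : ℕ) (hq : 0 < q) (z : ℕ → ℝ) :
    ∃ i j : ℕ, i < j ∧ j ≤ q ∧ ∃ m : ℤ, |z j - z i - m| < 1 / q := by
  have hq' : (0:ℝ) < q := by positivity
  have hmap : ∀ i ∈ Finset.range (q+1), ⌊Int.fract (z i) * q⌋₊ ∈ Finset.range q := by
    intro i _
    rw [Finset.mem_range, Nat.floor_lt (by have := Int.fract_nonneg (z i); positivity)]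
    nlinarith [Int.fract_lt_one (z i)]
  obtain ⟨i, hi, j, hj, hne, e⟩ := Finset.exists_ne_map_eq_of_card_lt_of_maps_to (by simp) hmap
  have key : ∀ i j, ⌊Int.fract (z i) * q⌋₊ = ⌊Int.fract (z j) * q⌋₊ →
      ∃ m : ℤ, |z j - z i - m| < 1 / q := by
    intro i j e
    refine ⟨⌊z j⌋ - ⌊z i⌋, ?_⟩
    have e1 : z j - z i - ((⌊z j⌋ - ⌊z i⌋ : ℤ) : ℝ) = Int.fract (z j) - Int.fract (z i) := by
      push_cast [Int.fract]; ring
    rw [e1, lt_div_iff₀ hq']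
    have e2 : |Int.fract (z j) - Int.fract (z i)| * q = |Int.fract (z j) * q - Int.fract (z i) * q| := by
      rw [← sub_mul, abs_mul, abs_of_pos hq']
    rw [e2]
    have n1 : 0 ≤ Int.fract (z i) * q := mul_nonneg (Int.fract_nonneg _) hq'.le
    have n2 : 0 ≤ Int.fract (z j) * q := mul_nonneg (Int.fract_nonneg _) hq'.le
    have a1 := Nat.floor_le n1
    have a2 := Nat.floor_le n2
    have a3 := Nat.lt_floor_add_one (Int.fract (z i) * q)
    have a4 := Nat.lt_floor_add_one (Int.fract (z j) * q)
    rw [e] at a1 a3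
    rw [abs_lt]; constructor <;> linarith
  simp only [Finset.mem_range] at hi hj
  rcases lt_or_gt_of_ne hne with hlt | hlt
  · exact ⟨i, j, hlt, by omega, key i j e⟩
  · exact ⟨j, i, hlt, by omega, key j i e.symm⟩

lemma Sys.disp (h : Sys f g N S M) {α : ℝ}
    (hα : ∀ x, Tendsto (fun n : ℕ => (f^[n] x - x) / n) atTop (nhds α)) {q : ℕ} (hq : 0 < q)
    {p : ℤ} (hb : ∀ l : ℕ, 0 < l → l < q → ∀ m : ℤ, |q * α - p| < |l * α - m|)
    (hθ : |q * α - p| < 1 / 2) (hP : ∀ i ≤ q, ∀ x, 1 / 4 ≤ PP f g i x) (x : ℝ) :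
    |f^[q] x - x - p| ≤ 4 / q := by
  have hq' : (0:ℝ) < q := by positivity
  by_contra! hcon
  obtain ⟨i, j, hij, hjq, m, hm⟩ := pigeon q hq (fun i => f^[i] x)
  have e4 : (4:ℝ) / q = 4 * (1 / q) := by ring
  rw [e4] at hcon
  -- displacement along the orbit
  have lowgrow : ∀ k ≤ q, ∀ u v : ℝ, u ≤ v → (v - u) / 4 ≤ f^[k] v - f^[k] u := by
    intro k hk u v huv
    have := mul_sub_le_image_sub_of_le_deriv (f := f^[k])
      (fun x => (h.deriv_iter k x).differentiableAt)
      (fun x => by rw [(h.deriv_iter k x).deriv]; exact hP k hk x) huv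
    linarith
  have comm : ∀ k, f^[k] (f^[q] x - p) = f^[q] (f^[k] x) - p := by
    intro k
    have := h.iter_add_int k (f^[q] x) (-p)
    push_cast at this
    rw [sub_eq_add_neg, this, ← iterate_add_apply, ← iterate_add_apply, add_comm k q]; ring
  obtain ⟨l, rfl⟩ : ∃ l, j = i + l := ⟨j - i, by omega⟩
  have hl0 : 0 < l := by omega
  have ezj : f^[i + l] x = f^[l] (f^[i] x) := by rw [add_comm, iterate_add_apply]
  set y := f^[i] x with hy
  have hmain : |l * α - m| ≤ |q * α - p| := by
    have o := @Sys.order f g N S M h α hα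
    rcases le_or_gt 0 (f^[q] x - x - p) with hs | hs
    · rw [abs_of_nonneg hs] at hcon
      have di := lowgrow i (by omega) x (f^[q] x - p) (by linarith)
      have dj := lowgrow (i+l) (by omega) x (f^[q] x - p) (by linarith)
      rw [comm] at di dj
      rw [ezj] at dj hm
      rw [← hy] at di
      rw [abs_lt] at hm
      rw [← iterate_add_apply f q l y] at dj
      have hth : 0 ≤ q * α - p := by
        have := @o 0 q 0 (-p) x (by push_cast; simp; linarith)
        push_cast at this; linarith
      rw [abs_of_nonneg hth, abs_le]
      rcases le_or_gt 0 (f^[l] y - y - m) with he | he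
      · have o1 := @o 0 l 0 (-m) y (by push_cast; simp; linarith)
        have o2 := @o l q (-m) (-p) y (by push_cast; linarith)
        push_cast at o1 o2
        constructor <;> linarith
      · have o1 := @o l 0 (-m) 0 y (by push_cast; simp; linarith)
        have o2 := @o 0 (q+l) 0 (-p-m) y (by push_cast; simp; linarith)
        push_cast at o1 o2
        constructor <;> linarith
    · rw [abs_of_neg hs] at hcon
      have di := lowgrow i (by omega) (f^[q] x - p) x (by linarith)
      have dj := lowgrow (i+l) (by omega) (f^[q] x - p) x (by linarith)
      rw [comm] at di dj
      rw [ezj] at dj hm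
      rw [← hy] at di
      rw [abs_lt] at hm
      rw [← iterate_add_apply f q l y] at dj
      have hth : q * α - p ≤ 0 := by
        have := @o q 0 (-p) 0 x (by push_cast; simp; linarith)
        push_cast at this; linarith
      rw [abs_of_nonpos hth, abs_le]
      rcases le_or_gt 0 (f^[l] y - y - m) with he | he
      · have o1 := @o 0 l 0 (-m) y (by push_cast; simp; linarith)
        have o2 := @o (q+l) 0 (-p-m) 0 y (by push_cast; simp; linarith)
        push_cast at o1 o2
        constructor <;> linarith
      · have o1 := @o l 0 (-m) 0 y (by push_cast; simp; linarith)
        have o2 := @o q l (-p) (-m) y (by push_cast; linarith)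
        push_cast at o1 o2
        constructor <;> linarith
  rcases lt_or_ge l q with hlq | hlq
  · exact absurd hmain (not_le.2 (hb l hl0 hlq m))
  · have hl : l = q := by omega
    have hi : i = 0 := by omega
    subst hl
    subst hi
    simp only [iterate_zero, id] at hy
    rw [zero_add] at hm
    rw [hy] at hm
    have hmp : m = p := by
      have : |((m - p : ℤ) : ℝ)| < 1 := by
        push_cast
        calc |(m:ℝ) - p| = |(l * α - p) - (l * α - m)| := by ring_nf
          _ ≤ |l * α - p| + |l * α - m| := abs_sub _ _
          _ < 1 := by linarith
      have h3 : |m - p| < 1 := by exact_mod_cast this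
      rw [Int.abs_lt_one_iff] at h3; omega
    rw [hmp] at hm
    have : (0:ℝ) < 1 / l := by positivity
    linarith

lemma PP_add (a b : ℕ) (x : ℝ) : PP f g (a + b) x = PP f g a x * PP f g b (f^[a] x) := by
  simp only [PP, Finset.prod_range_add]
  congr 1
  refine Finset.prod_congr rfl fun i _ => ?_
  rw [add_comm, iterate_add_apply]

lemma Sys.log_mul_bound (h : Sys f g N S M) {q : ℕ} {B : ℝ} (hB : ∀ x, |log (PP f g q x)| ≤ B)
    (a : ℕ) (x : ℝ) : |log (PP f g (q * a) x)| ≤ a * B := by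
  induction a with
  | zero => simp [PP]
  | succ a ih =>
    rw [mul_add, mul_one, PP_add, log_mul (h.PP_pos _ _).ne' (h.PP_pos _ _).ne']
    refine (abs_add_le _ _).trans ?_
    push_cast
    linarith [hB (f^[q * a] x)]

lemma abs_log_le {y : ℝ} (hy : 1 / 4 ≤ y) : |log y| ≤ 4 * |y - 1| := by
  have hp : 0 < y := by linarith
  have h1 := log_le_sub_one_of_pos hp
  have h2 := one_sub_inv_le_log_of_pos hp
  have h3 : 1 - y⁻¹ = (y - 1) / y := by field_simp
  rw [h3] at h2
  rw [abs_le]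
  constructor
  · have : -(4 * |y - 1|) ≤ (y-1)/y := by
      rw [le_div_iff₀ hp]
      nlinarith [neg_abs_le (y-1), abs_nonneg (y-1)]
    linarith
  · linarith [le_abs_self (y-1), abs_nonneg (y-1)]

lemma Sys.logq (h : Sys f g N S M) {α : ℝ}
    (hα : ∀ x, Tendsto (fun n : ℕ => (f^[n] x - x) / n) atTop (nhds α)) {q : ℕ} (hq : 0 < q)
    {p : ℤ} (hb : ∀ l : ℕ, 0 < l → l < q → ∀ m : ℤ, |q * α - p| < |l * α - m|)
    (hθ : |q * α - p| < 1 / 2) (hP1 : ∀ i < q, ∀ x, 1 / 2 ≤ PP f g i x)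
    (hP2 : ∀ i < q, ∀ x, PP f g i x ≤ 2) (x : ℝ) :
    |log (PP f g q x)| ≤ 48 * (8 * M) ^ (1/4:ℝ) * (q:ℝ) ^ (-(1/4):ℝ) := by
  have hq' : (0:ℝ) < q := by positivity
  have hM := h.hM
  have hPq : ∀ x, 1 / 4 ≤ PP f g q x ∧ PP f g q x ≤ 4 := by
    intro x
    obtain ⟨r, rfl⟩ : ∃ r, q = r + 1 := ⟨q - 1, by omega⟩
    rw [PP_succ]
    have a1 := hP1 r (by omega) x
    have a2 := hP2 r (by omega) x
    have a3 := h.g1 (f^[r] x)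
    have a4 := h.g2 (f^[r] x)
    constructor <;> nlinarith
  have hd := h.disp hα hq hb hθ (fun i hi x => by
    rcases hi.lt_or_eq with hi | rfl
    · linarith [hP1 i hi x]
    · exact (hPq x).1)
  have hB : 0 < 4 * √(8 * M * q) := by positivity
  have := interp (d := fun x => f^[q] x - x - p) (d1 := fun x => PP f g q x - 1)
    (d2 := fun x => PP f g q x * Ph f g N q x) (A := 4 / q) (B := 4 * √(8 * M * q)) (by positivity) hB
    (fun x => ((h.deriv_iter q x).sub (hasDerivAt_id x)).sub_const _)
    (fun x => (h.deriv_PP q x).sub_const _) hd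
    (fun x => by
      rw [abs_mul, abs_of_pos (h.PP_pos q x)]
      gcongr
      · exact (hPq x).2
      · exact h.Ph_bound q hP2 x) x
  refine (abs_log_le (hPq x).1).trans ?_
  have e : √(4 / q * (4 * √(8 * M * q))) = 4 * (8 * M) ^ (1/4:ℝ) * (q:ℝ) ^ (-(1/4):ℝ) := by
    rw [Real.sqrt_eq_iff_mul_self_eq (by positivity) (by positivity)]
    rw [Real.sqrt_eq_rpow, Real.mul_rpow (by positivity) (by positivity)]
    have e1 : (8 * M) ^ (1/4:ℝ) * (8 * M) ^ (1/4:ℝ) = (8 * M) ^ (1/2:ℝ) := by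
      rw [← Real.rpow_add (by positivity)]; norm_num
    have e2 : (q:ℝ) ^ (-(1/4):ℝ) * (q:ℝ) ^ (-(1/4):ℝ) = (q:ℝ) ^ (1/2:ℝ) / q := by
      rw [← Real.rpow_add hq', ← Real.rpow_sub_one hq'.ne']; norm_num
    symm
    calc _ = 16 * ((8 * M) ^ (1/4:ℝ) * (8 * M) ^ (1/4:ℝ)) * ((q:ℝ) ^ (-(1/4):ℝ) * (q:ℝ) ^ (-(1/4):ℝ)) := by ring
      _ = _ := by rw [e1, e2]; ring
  rw [e] at this
  linarith

def Dio (K α : ℝ) : Prop := ∀ q : ℕ, 0 < q → ∀ p : ℤ, K / (q:ℝ) ^ (10/9:ℝ) ≤ |q * α - p|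

lemma Dio.dirichlet {K α : ℝ} (hK : 0 < K) (h : Dio K α) {n : ℕ} (hn : 0 < n) :
    ∃ q : ℕ, 0 < q ∧ q ≤ n ∧ ∃ p : ℤ, (∀ l : ℕ, 0 < l → l < q → ∀ m : ℤ, |q * α - p| < |l * α - m|) ∧
      |q * α - p| < 1 / 2 ∧ K * n ≤ (q:ℝ) ^ (10/9:ℝ) := by
  classical
  have hex := Real.exists_nat_abs_mul_sub_round_le α hn
  set q := Nat.find hex with hqdef
  obtain ⟨h0, h1, h2⟩ := Nat.find_spec hex
  rw [← hqdef] at h0 h1 h2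
  have hq' : (0:ℝ) < q := by positivity
  have hn' : (1:ℝ) ≤ n := by exact_mod_cast hn
  refine ⟨q, h0, h1, round (q * α), ?_, ?_, ?_⟩
  · intro l hl hlq m
    have := Nat.find_min hex hlq
    have h3 : ¬ |l * α - round (l * α)| ≤ 1 / (n + 1) := fun h => this ⟨hl, by omega, h⟩
    exact h2.trans_lt ((not_le.1 h3).trans_le (round_le _ _))
  · have hle : |q * α - round (q * α)| ≤ 1 / 2 := abs_sub_round _
    refine lt_of_le_of_ne hle fun he => ?_
    have hpos : 0 < K / ((2 * q : ℕ):ℝ) ^ (10/9:ℝ) := by positivity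
    rcases abs_choice (q * α - round (q * α)) with hc | hc
    · have := h (2 * q) (by omega) (2 * round (q * α) + 1)
      have e : ((2 * q : ℕ):ℝ) * α - ((2 * round (q * α) + 1 : ℤ) : ℝ) = 0 := by
        push_cast; linarith
      rw [e, abs_zero] at this; linarith
    · have := h (2 * q) (by omega) (2 * round (q * α) - 1)
      have e : ((2 * q : ℕ):ℝ) * α - ((2 * round (q * α) - 1 : ℤ) : ℝ) = 0 := by
        push_cast; linarith
      rw [e, abs_zero] at this; linarith
  · have h3 := (h q h0 (round (q * α))).trans h2
    rw [div_le_div_iff₀ (by positivity) (by positivity)] at h3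
    nlinarith

lemma Sys.main (h : Sys f g N S M) {α K c : ℝ} (hK : 0 < K) (hD : Dio K α)
    (hα : ∀ x, Tendsto (fun n : ℕ => (f^[n] x - x) / n) atTop (nhds α))
    (hc : c = 48 * (8 * M) ^ (1/4:ℝ) * K ^ (-(9/8):ℝ)) (hc2 : 40 * c ≤ log 2) (n : ℕ) :
    ∀ x, |log (PP f g n x)| ≤ 20 * c * (2 - (n:ℝ) ^ (-(1/8):ℝ)) := by
  have hM := h.hM
  have hc0 : 0 < c := by rw [hc]; positivity
  induction n using Nat.strong_induction_on with
  | _ n ih =>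
  rcases Nat.eq_zero_or_pos n with rfl | hn
  · intro x
    simp only [PP, Finset.range_zero, Finset.prod_empty, log_one, abs_zero, Nat.cast_zero]
    rw [Real.zero_rpow (by norm_num)]; linarith
  obtain ⟨q, hq, hqn, p, hb, hθ, hqK⟩ := hD.dirichlet hK hn
  have hq' : (0:ℝ) < q := by positivity
  have hn' : (0:ℝ) < n := by positivity
  have hlog : ∀ i < n, ∀ x, |log (PP f g i x)| ≤ log 2 := by
    intro i hi x
    refine (ih i hi x).trans ?_
    have : (0:ℝ) ≤ (i:ℝ) ^ (-(1/8):ℝ) := by positivity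
    nlinarith
  have hP1 : ∀ i < q, ∀ x, 1 / 2 ≤ PP f g i x := by
    intro i hi x
    have := (abs_le.1 (hlog i (by omega) x)).1
    rw [← log_inv, log_le_log_iff (by norm_num) (h.PP_pos i x)] at this
    linarith
  have hP2 : ∀ i < q, ∀ x, PP f g i x ≤ 2 := by
    intro i hi x
    have := (abs_le.1 (hlog i (by omega) x)).2
    rwa [log_le_log_iff (h.PP_pos i x) (by norm_num)] at this
  have hL := h.logq hα hq hb hθ hP1 hP2
  have hkey : ((n / q : ℕ) : ℝ) * (48 * (8 * M) ^ (1/4:ℝ) * (q:ℝ) ^ (-(1/4):ℝ))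
      ≤ c * (n:ℝ) ^ (-(1/8):ℝ) := by
    have e1 : ((n / q : ℕ) : ℝ) ≤ n / q := Nat.cast_div_le
    have e2 : (q:ℝ) ^ (-(5/4):ℝ) ≤ (K * n) ^ (-(9/8):ℝ) := by
      have : (q:ℝ) ^ (-(5/4):ℝ) = ((q:ℝ) ^ (10/9:ℝ)) ^ (-(9/8):ℝ) := by
        rw [← Real.rpow_mul hq'.le]; norm_num
      rw [this]
      exact Real.rpow_le_rpow_of_nonpos (by positivity) hqK (by norm_num)
    have e3 : (q:ℝ) ^ (-(5/4):ℝ) = (q:ℝ) ^ (-(1/4):ℝ) / q := by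
      rw [← Real.rpow_sub_one hq'.ne']; norm_num
    have e4 : (n:ℝ) * (K * n) ^ (-(9/8):ℝ) = K ^ (-(9/8):ℝ) * (n:ℝ) ^ (-(1/8):ℝ) := by
      rw [Real.mul_rpow hK.le hn'.le]
      have : (n:ℝ) ^ (-(1/8):ℝ) = (n:ℝ) ^ (-(9/8):ℝ) * n := by
        rw [← Real.rpow_add_one hn'.ne']; norm_num
      rw [this]; ring
    calc _ ≤ (n / q : ℝ) * (48 * (8 * M) ^ (1/4:ℝ) * (q:ℝ) ^ (-(1/4):ℝ)) := by gcongr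
      _ = 48 * (8 * M) ^ (1/4:ℝ) * (n * (q:ℝ) ^ (-(5/4):ℝ)) := by rw [e3]; ring
      _ ≤ 48 * (8 * M) ^ (1/4:ℝ) * (n * (K * n) ^ (-(9/8):ℝ)) := by gcongr
      _ = _ := by rw [e4, hc]; ring
  intro x
  have hsplit : |log (PP f g n x)| ≤ c * (n:ℝ) ^ (-(1/8):ℝ) + |log (PP f g (n % q) (f^[q * (n / q)] x))| := by
    conv_lhs => rw [← Nat.div_add_mod n q]
    rw [PP_add, log_mul (h.PP_pos _ _).ne' (h.PP_pos _ _).ne']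
    refine (abs_add_le _ _).trans ?_
    have := h.log_mul_bound hL (n / q) x
    linarith
  have hn1 : (n:ℝ) ^ (-(1/8):ℝ) ≤ 1 :=
    Real.rpow_le_one_of_one_le_of_nonpos (by exact_mod_cast hn) (by norm_num)
  rcases Nat.eq_zero_or_pos (n % q) with hr | hr
  · rw [hr] at hsplit
    simp [PP] at hsplit
    simp only [PP]
    norm_num at hsplit hn1 ⊢
    nlinarith
  · have hrq := Nat.mod_lt n hq
    have hdm := Nat.div_add_mod n q
    have hdiv : 1 ≤ n / q := Nat.div_pos hqn hq
    have h2r : 2 * (n % q) ≤ n := by nlinarith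
    have := ih (n % q) (by omega) (f^[q * (n / q)] x)
    have hr' : (0:ℝ) < (n % q : ℕ) := by positivity
    have e5 : (21/20) * (n:ℝ) ^ (-(1/8):ℝ) ≤ ((n % q : ℕ):ℝ) ^ (-(1/8):ℝ) := by
      have h2r' : (2:ℝ) * (n % q : ℕ) ≤ n := by exact_mod_cast h2r
      have t1 : (n:ℝ) ^ (-(1/8):ℝ) ≤ ((2:ℝ) * (n % q : ℕ)) ^ (-(1/8):ℝ) :=
        Real.rpow_le_rpow_of_nonpos (by positivity) h2r' (by norm_num)
      rw [Real.mul_rpow (by norm_num) hr'.le] at t1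
      have t2 : (2:ℝ) ^ (-(1/8):ℝ) ≤ 20/21 := by
        rw [Real.rpow_neg (by norm_num), inv_le_comm₀ (by positivity) (by norm_num)]
        have u1 : (((21/20:ℝ) ^ (8:ℝ)) ^ (1/8:ℝ)) = 21/20 := by
          rw [← Real.rpow_mul (by norm_num)]; norm_num
        have u2 : ((21/20:ℝ) ^ (8:ℝ)) ^ (1/8:ℝ) ≤ 2 ^ (1/8:ℝ) := by
          apply Real.rpow_le_rpow (by positivity) _ (by norm_num)
          rw [show (8:ℝ) = ((8:ℕ):ℝ) by norm_num, Real.rpow_natCast]; norm_num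
        rw [u1] at u2
        norm_num at u2 ⊢; exact u2
      have t3 : 0 < ((n % q : ℕ):ℝ) ^ (-(1/8):ℝ) := by positivity
      nlinarith
    nlinarith

def gS (ε x : ℝ) : ℝ := 1 - ε * (cos (2 * π * x) * (2 * π))
def NS (ε x : ℝ) : ℝ := ε * (2 * π) ^ 2 * sin (2 * π * x) / gS ε x
def SS (ε x : ℝ) : ℝ := ε * (2 * π) ^ 3 * cos (2 * π * x) / gS ε x - 3 / 2 * NS ε x ^ 2

lemma gS_bd {ε : ℝ} (h0 : 0 < ε) (h1 : ε ≤ 1 / 100) (x : ℝ) : 1 / 2 ≤ gS ε x ∧ gS ε x ≤ 2 := by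
  have hpi := Real.pi_lt_d2
  have hpi0 := Real.pi_pos
  have : |ε * (cos (2 * π * x) * (2 * π))| ≤ 1 / 2 := by
    rw [abs_mul, abs_mul, abs_of_pos h0, abs_of_pos (show 0 < 2 * π by positivity)]
    have := abs_cos_le_one (2 * π * x)
    calc _ ≤ (1/100) * (1 * (2 * π)) := by gcongr
      _ ≤ _ := by linarith
  rw [abs_le] at this
  unfold gS
  constructor <;> linarith

lemma sysStd {ε : ℝ} (h0 : 0 < ε) (h1 : ε ≤ 1 / 100) (τ : ℝ) :
    Sys (fStd τ ε) (gS ε) (NS ε) (SS ε) (1000 * ε) := by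
  have hlin : ∀ x : ℝ, HasDerivAt (fun x => 2 * π * x) (2 * π) x := fun x => by
    simpa using (hasDerivAt_id x).const_mul (2 * π)
  have hg0 : ∀ x, gS ε x ≠ 0 := fun x => by linarith [(gS_bd h0 h1 x).1] |> fun h => ne_of_gt h
  have hg : ∀ x, HasDerivAt (gS ε) (gS ε x * NS ε x) x := fun x => by
    have := (((hlin x).cos.mul_const (2 * π)).const_mul ε).const_sub 1
    refine this.congr_deriv ?_
    rw [NS, mul_div_cancel₀ _ (hg0 x)]; ring
  have hper : ∀ x : ℝ, 2 * π * (x + 1) = 2 * π * x + 2 * π := fun x => by ring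
  have pg : ∀ x, gS ε (x + 1) = gS ε x := fun x => by simp [gS, hper]
  have hpi := Real.pi_lt_d2
  have hpi0 := Real.pi_pos
  refine ⟨fun x => ?_, hg, fun x => ?_, fun x => ?_, pg, fun x => ?_,
    fun x => (gS_bd h0 h1 x).1, fun x => (gS_bd h0 h1 x).2, fun x => ?_, by linarith⟩
  · exact (((hasDerivAt_id x).add_const τ).sub ((hlin x).sin.const_mul ε))
  · have := ((hlin x).sin.const_mul (ε * (2 * π) ^ 2)).div (hg x) (hg0 x)
    refine this.congr_deriv ?_
    have := hg0 x
    simp only [SS, NS]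
    field_simp
    ring
  · simp [fStd, hper]; ring
  · simp [NS, pg, hper]
  · have hgb := (gS_bd h0 h1 x).1
    have hgp : 0 < gS ε x := by linarith
    have hinv : 1 / gS ε x ≤ 2 := by rw [div_le_iff₀ hgp]; linarith
    have hs := abs_sin_le_one (2 * π * x)
    have hc := abs_cos_le_one (2 * π * x)
    have hN : |NS ε x| ≤ 98 * ε := by
      rw [NS, div_eq_mul_one_div, abs_mul, abs_mul, abs_mul, abs_of_pos h0,
        abs_of_pos (show 0 < (2 * π)^2 by positivity), abs_of_pos (show 0 < 1 / gS ε x by positivity)]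
      calc _ ≤ ε * 7 ^ 2 * 1 * 2 := by gcongr; linarith
        _ = _ := by ring
    have hC : |ε * (2 * π) ^ 3 * cos (2 * π * x) / gS ε x| ≤ 686 * ε := by
      rw [div_eq_mul_one_div, abs_mul, abs_mul, abs_mul, abs_of_pos h0,
        abs_of_pos (show 0 < (2 * π)^3 by positivity), abs_of_pos (show 0 < 1 / gS ε x by positivity)]
      calc _ ≤ ε * 7 ^ 3 * 1 * 2 := by gcongr; linarith
        _ = _ := by ring
    have hN2 : NS ε x ^ 2 ≤ 97 * ε := by
      rw [← sq_abs]
      have := abs_nonneg (NS ε x)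
      nlinarith
    rw [SS]
    refine (abs_sub _ _).trans ?_
    rw [abs_of_nonneg (show 0 ≤ 3 / 2 * NS ε x ^ 2 by positivity)]
    linarith

def liftStd (ε : ℝ) (h0 : 0 < ε) (h1 : ε ≤ 1 / 100) (τ : ℝ) : CircleDeg1Lift where
  toFun := fStd τ ε
  monotone' := by simpa using ((sysStd h0 h1 τ).mono_iter 1).monotone
  map_add_one' := (sysStd h0 h1 τ).pf

lemma liftStd_coe {ε : ℝ} (h0 : 0 < ε) (h1 : ε ≤ 1 / 100) (τ : ℝ) :
    (liftStd ε h0 h1 τ : ℝ → ℝ) = fStd τ ε := rfl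

lemma liftStd_rho {ε : ℝ} (h0 : 0 < ε) (h1 : ε ≤ 1 / 100) {ρ : ℝ → ℝ}
    (hρ : ∀ τ x : ℝ, Tendsto (fun n : ℕ => ((fStd τ ε)^[n] x - x) / n) atTop (nhds (ρ τ))) (τ : ℝ) :
    (liftStd ε h0 h1 τ).translationNumber = ρ τ := by
  refine tendsto_nhds_unique ((liftStd ε h0 h1 τ).tendsto_translationNumber 0) ?_
  simpa only [CircleDeg1Lift.coe_pow, liftStd_coe] using hρ τ 0

lemma rho_props {ε : ℝ} (h0 : 0 < ε) (h1 : ε ≤ 1 / 100) {ρ : ℝ → ℝ}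
    (hρ : ∀ τ x : ℝ, Tendsto (fun n : ℕ => ((fStd τ ε)^[n] x - x) / n) atTop (nhds (ρ τ))) :
    Continuous ρ ∧ Monotone ρ ∧ ρ 0 = 0 ∧ ρ 1 = 1 := by
  have e := liftStd_rho h0 h1 hρ
  refine ⟨?_, ?_, ?_, ?_⟩
  · have hu : TendstoUniformly (fun (n : ℕ) τ => (fStd τ ε)^[n] 0 / n) ρ atTop := by
      rw [Metric.tendstoUniformly_iff]
      intro δ hδ
      obtain ⟨m, hm⟩ := exists_nat_gt (1 / δ)
      filter_upwards [eventually_ge_atTop (m + 1)] with n hn τ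
      have hn0 : (0:ℝ) < n := by exact_mod_cast (by omega : 0 < n)
      have hmn : (m:ℝ) < n := by exact_mod_cast (by omega : m < n)
      have := (liftStd ε h0 h1 τ).dist_pow_map_zero_mul_translationNumber_le n
      rw [e, CircleDeg1Lift.coe_pow, liftStd_coe, Real.dist_eq] at this
      rw [dist_comm, Real.dist_eq]
      have e2 : (fStd τ ε)^[n] 0 / n - ρ τ = ((fStd τ ε)^[n] 0 - n * ρ τ) / n := by field_simp
      rw [e2, abs_div, abs_of_pos hn0, div_lt_iff₀ hn0]
      rw [div_lt_iff₀ hδ] at hm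
      nlinarith
    refine hu.continuous (Eventually.frequently (Eventually.of_forall fun n => ?_))
    refine Continuous.div_const ?_ _
    induction n with
    | zero => simpa using continuous_const
    | succ n ih =>
      simp only [iterate_succ_apply']
      simp only [fStd] at ih ⊢
      fun_prop
  · intro a b hab
    rw [← e, ← e]
    apply CircleDeg1Lift.translationNumber_mono
    intro x
    simp only [liftStd_coe, fStd]; linarith
  · rw [← e]
    have := (liftStd ε h0 h1 0).translationNumber_of_eq_add_int (x := 0) (m := 0)
      (by simp [liftStd_coe, fStd])
    simpa using this
  · rw [← e]
    have := (liftStd ε h0 h1 1).translationNumber_of_eq_add_int (x := 0) (m := 1)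
      (by simp [liftStd_coe, fStd])
    simpa using this

lemma rho_lip {ε : ℝ} (h0 : 0 < ε) (h1 : ε ≤ 1 / 100) {ρ : ℝ → ℝ}
    (hρ : ∀ τ x : ℝ, Tendsto (fun n : ℕ => ((fStd τ ε)^[n] x - x) / n) atTop (nhds (ρ τ)))
    {τ σ L : ℝ} (hτσ : τ ≤ σ) (hL : ∀ n x, PP (fStd τ ε) (gS ε) n x ≤ L) :
    ρ σ ≤ ρ τ + L * (σ - τ) := by
  have h := sysStd h0 h1 τ
  have hstep : ∀ n m : ℕ, (fStd τ ε)^[m] ((fStd σ ε)^[n] 0) ≤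
      (fStd τ ε)^[m + n] 0 + n * (L * (σ - τ)) := by
    intro n
    induction n with
    | zero => intro m; simp
    | succ n ih =>
      intro m
      set y := (fStd σ ε)^[n] 0 with hy
      have e1 : (fStd σ ε)^[n+1] 0 = fStd τ ε y + (σ - τ) := by
        rw [iterate_succ_apply', ← hy]; simp only [fStd]; ring
      have e2 : (fStd τ ε)^[m] (fStd τ ε y + (σ - τ)) - (fStd τ ε)^[m] (fStd τ ε y) ≤
          L * (σ - τ) := by
        have := image_sub_le_mul_sub_of_deriv_le (f := (fStd τ ε)^[m]) (C := L)
          (fun x => (h.deriv_iter m x).differentiableAt)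
          (fun x => by rw [(h.deriv_iter m x).deriv]; exact hL m x)
          (show fStd τ ε y ≤ fStd τ ε y + (σ - τ) by linarith)
        simpa using this
      have e3 := ih (m + 1)
      rw [iterate_succ_apply] at e3
      rw [e1, show m + (n + 1) = m + 1 + n by ring]
      push_cast
      linarith
  refine le_of_tendsto_of_tendsto (hρ σ 0) ((hρ τ 0).add_const (L * (σ - τ))) ?_
  filter_upwards [eventually_gt_atTop 0] with n hn
  have hn0 : (0:ℝ) < n := by exact_mod_cast hn
  have := hstep n 0
  simp only [iterate_zero, id, zero_add] at this
  rw [sub_zero, sub_zero, div_le_iff₀ hn0, add_mul, div_mul_cancel₀ _ hn0.ne']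
  linarith

lemma Dio_closed (K : ℝ) : IsClosed {α | Dio K α} := by
  simp only [Dio, setOf_forall]
  refine isClosed_iInter fun q => isClosed_iInter fun _ => isClosed_iInter fun p => ?_
  exact isClosed_le continuous_const (by fun_prop)

lemma Dio.irr {K α : ℝ} (hK : 0 < K) (h : Dio K α) (r : ℚ) : α ≠ r := by
  intro e
  have := h r.den r.den_pos r.num
  have hd : (0:ℝ) < r.den := by exact_mod_cast r.den_pos
  have e2 : (r.den:ℝ) * α - r.num = 0 := by
    rw [e]; nth_rewrite 2 [← Rat.num_div_den r]; push_cast; field_simp; ring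
  rw [e2, abs_zero] at this
  have : 0 < K / (r.den:ℝ) ^ (10/9:ℝ) := by positivity
  linarith

def ZZ : ℝ := ∑' n : ℕ, ((n + 1 : ℕ) : ℝ) ^ (-(10/9) : ℝ)

lemma sumZ : Summable fun n : ℕ => ((n + 1 : ℕ) : ℝ) ^ (-(10/9) : ℝ) :=
  (summable_nat_add_iff 1).2 (Real.summable_nat_rpow.2 (by norm_num))

lemma compl_Dio {K : ℝ} (hK : 0 < K) (hK1 : K ≤ 1) :
    volume {α ∈ Icc (0:ℝ) 1 | ¬ Dio K α} ≤ ENNReal.ofReal (8 * K * ZZ) := by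
  have hsub : {α ∈ Icc (0:ℝ) 1 | ¬ Dio K α} ⊆ ⋃ n : ℕ, ⋃ p ∈ Finset.Icc (-1 : ℤ) (n + 2),
      Metric.ball ((p:ℝ) / (n + 1 : ℕ)) (K * ((n + 1 : ℕ) : ℝ) ^ (-(19/9) : ℝ)) := by
    rintro α ⟨⟨ha0, ha1⟩, hnd⟩
    simp only [Dio, not_forall, not_le] at hnd
    obtain ⟨q, hq, p, hp⟩ := hnd
    obtain ⟨n, rfl⟩ : ∃ n, q = n + 1 := ⟨q - 1, by omega⟩
    have hq1 : (1:ℝ) ≤ ((n+1:ℕ):ℝ) := by exact_mod_cast hq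
    have hq0 : (0:ℝ) < ((n+1:ℕ):ℝ) := by linarith
    simp only [mem_iUnion]
    have hle : K / ((n+1:ℕ):ℝ) ^ (10/9:ℝ) ≤ 1 := by
      rw [div_le_one (by positivity)]
      exact hK1.trans (Real.one_le_rpow hq1 (by norm_num))
    have hp1 := hp.trans_le hle
    rw [abs_lt] at hp1
    refine ⟨n, p, ?_, ?_⟩
    · rw [Finset.mem_Icc]
      constructor
      · have : (-1:ℝ) < p := by nlinarith [hp1.2, mul_nonneg hq0.le ha0]
        have h3 : (-1:ℤ) < p := by exact_mod_cast this
        omega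
      · have : (p:ℝ) < n + 2 := by push_cast at *; nlinarith [hp1.1]
        have h3 : p < n + 2 := by exact_mod_cast this
        omega
    · rw [Metric.mem_ball, Real.dist_eq]
      have e1 : α - p / ((n+1:ℕ):ℝ) = (((n+1:ℕ):ℝ) * α - p) / ((n+1:ℕ):ℝ) := by field_simp
      have e2 : K * ((n + 1 : ℕ) : ℝ) ^ (-(19/9) : ℝ) = K / ((n+1:ℕ):ℝ) ^ (10/9:ℝ) / ((n+1:ℕ):ℝ) := by
        rw [show (-(19/9):ℝ) = -(10/9) - 1 by norm_num, Real.rpow_sub_one hq0.ne', Real.rpow_neg hq0.le]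
        ring
      rw [e1, e2, abs_div, abs_of_pos hq0]
      gcongr
  refine (measure_mono hsub).trans ((measure_iUnion_le _).trans ?_)
  have hterm : ∀ n : ℕ, volume (⋃ p ∈ Finset.Icc (-1 : ℤ) (n + 2),
      Metric.ball ((p:ℝ) / (n + 1 : ℕ)) (K * ((n + 1 : ℕ) : ℝ) ^ (-(19/9) : ℝ))) ≤
      ENNReal.ofReal (8 * K * ((n + 1 : ℕ) : ℝ) ^ (-(10/9) : ℝ)) := by
    intro n
    refine (measure_biUnion_finset_le _ _).trans ?_
    simp only [Real.volume_ball, Finset.sum_const, Int.card_Icc]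
    have hc : ((n:ℤ) + 2 + 1 - -1).toNat = n + 4 := by omega
    rw [hc, ← ENNReal.ofReal_nsmul]
    apply ENNReal.ofReal_le_ofReal
    have hq0 : (0:ℝ) < ((n+1:ℕ):ℝ) := by positivity
    have e2 : ((n + 1 : ℕ) : ℝ) ^ (-(10/9) : ℝ) = ((n + 1 : ℕ) : ℝ) ^ (-(19/9) : ℝ) * ((n+1:ℕ):ℝ) := by
      rw [← Real.rpow_add_one hq0.ne']; norm_num
    rw [e2, nsmul_eq_mul]
    have : 0 < ((n + 1 : ℕ) : ℝ) ^ (-(19/9) : ℝ) := by positivity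
    set w := ((n + 1 : ℕ) : ℝ) ^ (-(19/9) : ℝ)
    push_cast
    have h5 : (0:ℝ) ≤ n := by positivity
    have h6 : 0 < K * w := by positivity
    nlinarith [mul_nonneg h5 h6.le]
  refine (ENNReal.tsum_le_tsum hterm).trans ?_
  rw [← ENNReal.ofReal_tsum_of_nonneg (fun n => by positivity) (sumZ.mul_left _), tsum_mul_left]
  rfl

lemma key_bound (δ : ℝ) (hδ : 0 < δ) (hδ1 : δ < 1) : ∃ ε₀ > 0, ∀ ε, 0 < ε → ε < ε₀ →
    ∀ ρ : ℝ → ℝ, (∀ τ x : ℝ, Tendsto (fun n : ℕ => ((fStd τ ε)^[n] x - x) / n) atTop (nhds (ρ τ))) →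
    volume {τ ∈ Icc (0:ℝ) 1 | ∃ r : ℚ, ρ τ = (r : ℝ)} ≤ ENNReal.ofReal δ := by
  have hZ : 0 ≤ ZZ := tsum_nonneg fun n => by positivity
  obtain ⟨K, hK, hK1, hKZ⟩ : ∃ K : ℝ, 0 < K ∧ K ≤ 1 ∧ 8 * K * ZZ ≤ δ / 2 := by
    refine ⟨δ / (16 * (ZZ + 1)), by positivity, ?_, ?_⟩
    · rw [div_le_one (by positivity)]; linarith
    · rw [show 8 * (δ / (16 * (ZZ + 1))) * ZZ = δ / 2 * (ZZ / (ZZ + 1)) by field_simp; ring]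
      have : ZZ / (ZZ + 1) ≤ 1 := by rw [div_le_one (by positivity)]; linarith
      nlinarith
  have hlim : Tendsto (fun ε : ℝ => 40 * (48 * (8 * (1000 * ε)) ^ (1/4:ℝ) * K ^ (-(9/8):ℝ)))
      (nhds 0) (nhds 0) := by
    have : Continuous (fun ε : ℝ => 40 * (48 * (8 * (1000 * ε)) ^ (1/4:ℝ) * K ^ (-(9/8):ℝ))) := by
      have h1 : Continuous (fun ε : ℝ => (8 * (1000 * ε)) ^ (1/4:ℝ)) :=
        (by fun_prop : Continuous fun ε : ℝ => 8 * (1000 * ε)).rpow_const (fun _ => Or.inr (by norm_num))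
      fun_prop
    have := this.tendsto 0
    simpa using this
  have hlog : 0 < log (1 + δ / 2) := Real.log_pos (by linarith)
  have hev := hlim.eventually_lt_const hlog
  obtain ⟨ε₁, hε₁, hball⟩ := Metric.eventually_nhds_iff.1 hev
  refine ⟨min ε₁ (1/100), by positivity, fun ε h0 hlt ρ hρ => ?_⟩
  have h1 : ε ≤ 1 / 100 := hlt.le.trans (min_le_right _ _)
  have hc := @hball ε (by simpa [abs_of_pos h0] using hlt.trans_le (min_le_left _ _))
  obtain ⟨hcont, hmono, hr0, hr1⟩ := rho_props h0 h1 hρ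
  set L : ℝ := 1 + δ / 2 with hLdef
  have hPL : ∀ τ, Dio K (ρ τ) → ∀ n x, PP (fStd τ ε) (gS ε) n x ≤ L := by
    intro τ hτ n x
    have hs := sysStd h0 h1 τ
    have hm := hs.main hK hτ (hρ τ) rfl (by
      refine hc.le.trans ?_
      exact Real.log_le_log (by positivity) (by linarith)) n x
    have hpos : (0:ℝ) ≤ (n:ℝ) ^ (-(1/8):ℝ) := by positivity
    have hcp : 0 ≤ 48 * (8 * (1000 * ε)) ^ (1/4:ℝ) * K ^ (-(9/8):ℝ) := by positivity
    have : log (PP (fStd τ ε) (gS ε) n x) ≤ log L := by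
      refine (le_abs_self _).trans (hm.trans (le_trans ?_ hc.le))
      nlinarith
    exact (Real.log_le_log_iff (hs.PP_pos n x) (by positivity)).1 this
  set A := {τ ∈ Icc (0:ℝ) 1 | Dio K (ρ τ)} with hA
  have hAm : MeasurableSet A :=
    measurableSet_Icc.inter ((Dio_closed K).preimage hcont).measurableSet
  have hlip : LipschitzOnWith (Real.toNNReal L) ρ A := by
    have hw : ∀ x ∈ A, ∀ y ∈ A, x ≤ y → |ρ x - ρ y| ≤ L * |x - y| := by
      intro x hx y hy hxy
      rw [abs_sub_comm, abs_sub_comm x, abs_of_nonneg (by linarith [hmono hxy]),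
        abs_of_nonneg (by linarith)]
      linarith [rho_lip h0 h1 hρ hxy (hPL x hx.2)]
    refine LipschitzOnWith.of_dist_le_mul fun x hx y hy => ?_
    rw [Real.dist_eq, Real.dist_eq, Real.coe_toNNReal _ (by positivity)]
    rcases le_total x y with hxy | hxy
    · exact hw x hx y hy hxy
    · rw [abs_sub_comm, abs_sub_comm x]; exact hw y hy x hx hxy
  have hvol : volume (ρ '' A) ≤ ENNReal.ofReal L * volume A := by
    have := hlip.hausdorffMeasure_image_le (d := 1) zero_le_one
    rw [MeasureTheory.hausdorffMeasure_real] at this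
    simpa [ENNReal.ofReal] using this
  have hDsub : {α ∈ Icc (0:ℝ) 1 | Dio K α} ⊆ ρ '' A := by
    rintro α ⟨ha, hd⟩
    have := intermediate_value_Icc (zero_le_one (α := ℝ)) hcont.continuousOn
    rw [hr0, hr1] at this
    obtain ⟨τ, hτ, rfl⟩ := this ha
    exact ⟨τ, ⟨hτ, hd⟩, rfl⟩
  have hcover : (1 : ENNReal) ≤ ENNReal.ofReal L * volume A + ENNReal.ofReal (δ / 2) := by
    calc (1 : ENNReal) = volume (Icc (0:ℝ) 1) := by simp
      _ ≤ volume ({α ∈ Icc (0:ℝ) 1 | Dio K α} ∪ {α ∈ Icc (0:ℝ) 1 | ¬ Dio K α}) := by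
          apply measure_mono
          intro x hx
          by_cases h : Dio K x
          · exact Or.inl ⟨hx, h⟩
          · exact Or.inr ⟨hx, h⟩
      _ ≤ _ := (measure_union_le _ _).trans (add_le_add ((measure_mono hDsub).trans hvol)
          ((compl_Dio hK hK1).trans (ENNReal.ofReal_le_ofReal hKZ)))
  set R := {τ ∈ Icc (0:ℝ) 1 | ∃ r : ℚ, ρ τ = (r : ℝ)} with hR
  have hdisj : Disjoint R A := by
    rw [Set.disjoint_left]
    rintro τ ⟨_, r, hr⟩ ⟨_, hd⟩
    exact hd.irr hK r hr
  have hsum : volume R + volume A ≤ 1 := by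
    rw [← measure_union hdisj hAm]
    calc _ ≤ volume (Icc (0:ℝ) 1) := measure_mono (by
          rintro x (hx | hx)
          · exact hx.1
          · exact hx.1)
      _ = 1 := by simp
  have hRf : volume R ≠ ⊤ := ne_top_of_le_ne_top ENNReal.one_ne_top (le_self_add.trans hsum)
  have hAf : volume A ≠ ⊤ := ne_top_of_le_ne_top ENNReal.one_ne_top (le_add_self.trans hsum)
  rw [← ENNReal.ofReal_toReal hRf]
  apply ENNReal.ofReal_le_ofReal
  have s1 : (volume R).toReal + (volume A).toReal ≤ 1 := by
    rw [← ENNReal.toReal_add hRf hAf]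
    simpa using ENNReal.toReal_mono ENNReal.one_ne_top hsum
  have s2 : 1 ≤ L * (volume A).toReal + δ / 2 := by
    rw [← ENNReal.ofReal_toReal hAf, ← ENNReal.ofReal_mul (by positivity),
      ← ENNReal.ofReal_add (by positivity) (by positivity)] at hcover
    exact ENNReal.one_le_ofReal.1 hcover
  have s3 : 0 ≤ (volume A).toReal := ENNReal.toReal_nonneg
  have s4 : 0 ≤ (volume R).toReal := ENNReal.toReal_nonneg
  rw [hLdef] at s2
  nlinarith

end

/-- **The total width of the Arnol'd tongues vanishes as `ε → 0⁺`:** if `ρ(τ,ε)` is the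
rotation number of the standard map `f_{τ,ε}` (for `0 < 2πε < 1`), then the Lebesgue
measure of `R(ε) = {τ ∈ [0,1] : ρ(τ,ε) ∈ ℚ}` tends to `0` as `ε → 0⁺`; equivalently, the
measure of the set of `τ ∈ [0,1]` with irrational rotation number tends to `1`. -/
theorem arnold_tongues_measure_tendsto_zero
    (ρ : ℝ → ℝ → ℝ)
    (hρ : ∀ ε ∈ Ioo (0 : ℝ) (1 / (2 * π)), ∀ τ x : ℝ,
      Tendsto (fun n : ℕ => ((fStd τ ε)^[n] x - x) / n) atTop (nhds (ρ τ ε))) :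
    Tendsto (fun ε => volume {τ ∈ Icc (0:ℝ) 1 | ∃ r : ℚ, ρ τ ε = (r : ℝ)})
        (nhdsWithin 0 (Ioi 0)) (nhds 0) ∧
      Tendsto (fun ε => volume {τ ∈ Icc (0:ℝ) 1 | Irrational (ρ τ ε)})
        (nhdsWithin 0 (Ioi 0)) (nhds 1) := by
  have hsmall : (1:ℝ) / 100 < 1 / (2 * π) := by
    have := Real.pi_lt_d2
    have := Real.pi_pos
    apply one_div_lt_one_div_of_lt <;> linarith
  have hI : ∀ᶠ ε in nhdsWithin (0:ℝ) (Ioi 0), ε ∈ Ioo (0:ℝ) (1/100) :=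
    Ioo_mem_nhdsGT (by norm_num)
  have H1 : Tendsto (fun ε => volume {τ ∈ Icc (0:ℝ) 1 | ∃ r : ℚ, ρ τ ε = (r : ℝ)})
        (nhdsWithin 0 (Ioi 0)) (nhds 0) := by
    rw [ENNReal.tendsto_nhds_zero]
    intro e he
    obtain ⟨δ, hδ, hδ1, hδe⟩ : ∃ δ : ℝ, 0 < δ ∧ δ < 1 ∧ ENNReal.ofReal δ ≤ e := by
      rcases eq_or_ne e ⊤ with rfl | hne
      · exact ⟨1/2, by norm_num, by norm_num, le_top⟩
      · have hp := ENNReal.toReal_pos he.ne' hne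
        refine ⟨min e.toReal (1/2), by positivity, (min_le_right _ _).trans_lt (by norm_num), ?_⟩
        exact (ENNReal.ofReal_le_ofReal (min_le_left _ _)).trans (ENNReal.ofReal_toReal hne).le
    obtain ⟨ε₀, hε₀, hb⟩ := key_bound δ hδ hδ1
    have hI2 : ∀ᶠ ε in nhdsWithin (0:ℝ) (Ioi 0), ε ∈ Ioo (0:ℝ) ε₀ := Ioo_mem_nhdsGT hε₀
    filter_upwards [hI, hI2] with ε h1 h2
    exact (hb ε h1.1 h2.2 (fun τ => ρ τ ε) (hρ ε ⟨h1.1, h1.2.trans hsmall⟩)).trans hδe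
  refine ⟨H1, ?_⟩
  have H2 := ENNReal.Tendsto.sub (tendsto_const_nhds (x := (1:ENNReal))) H1 (Or.inl ENNReal.one_ne_top)
  rw [tsub_zero] at H2
  refine H2.congr' ?_
  filter_upwards [hI] with ε h1
  have hc := (rho_props h1.1 h1.2.le (hρ ε ⟨h1.1, h1.2.trans hsmall⟩)).1
  have hm : MeasurableSet {τ ∈ Icc (0:ℝ) 1 | ∃ r : ℚ, ρ τ ε = (r : ℝ)} := by
    have : {τ ∈ Icc (0:ℝ) 1 | ∃ r : ℚ, ρ τ ε = (r : ℝ)} =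
        Icc (0:ℝ) 1 ∩ ⋃ r : ℚ, (fun τ => ρ τ ε) ⁻¹' {(r:ℝ)} := by
      ext; simp
    rw [this]
    exact measurableSet_Icc.inter (MeasurableSet.iUnion fun r =>
      (isClosed_singleton.preimage hc).measurableSet)
  have hset : {τ ∈ Icc (0:ℝ) 1 | Irrational (ρ τ ε)} =
      Icc (0:ℝ) 1 \ {τ ∈ Icc (0:ℝ) 1 | ∃ r : ℚ, ρ τ ε = (r : ℝ)} := by
    ext τ
    simp only [mem_setOf_eq, Irrational, mem_diff, mem_range, not_and]
    constructor
    · rintro ⟨a, b⟩; exact ⟨a, fun _ ⟨r, hr⟩ => b ⟨r, hr.symm⟩⟩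
    · rintro ⟨a, b⟩; exact ⟨a, fun ⟨r, hr⟩ => b a ⟨r, hr.symm⟩⟩
  have hsub : {τ ∈ Icc (0:ℝ) 1 | ∃ r : ℚ, ρ τ ε = (r : ℝ)} ⊆ Icc (0:ℝ) 1 := fun x hx => hx.1
  rw [hset, measure_diff hsub hm.nullMeasurableSet
    (ne_top_of_le_ne_top (by simp) (measure_mono hsub))]
  simp
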